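/- If gcd(a, b) = 1 (a > 0, b < 0, gcd(a,-b)=1), then for any word u obtained as the modular sweep of a rational Dyck word in D_{a,b} (with letters taken mod a sufficiently large m), the only balanced block-suffix of any equitable partition of u is the entire partitioned word; consequently the distributive lattice of equitable partitions of u is a chain. -/

import Mathlib

/-- Modular level of the `j`-th letter (0-indexed) of `w`: sum of the first `j+1` letters in `Fin m`. -/
def modLevel (m : ℕ) [NeZero m] (w : List (Fin m)) (j : ℕ) : Fin m :=
  (w.take (j+1)).sum

/-- The modular sweep map: for k = m-1,…,0, read `w` right-to-left and append letters of level k. -/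
def msweep (m : ℕ) [NeZero m] (w : List (Fin m)) : List (Fin m) :=
  ((List.range m).reverse).flatMap (fun k =>
    ((List.range w.length).reverse).filterMap (fun j =>
      if (modLevel m w j : ℕ) = k then some (w.getD j 0) else none))

/-- The modular presweep map: block `k` consists of the letters of level `k`, read right-to-left. -/
def presweep (m : ℕ) [NeZero m] (w : List (Fin m)) (k : Fin m) : List (Fin m) :=
  ((List.range w.length).reverse).filterMap (fun j =>
    if modLevel m w j = k then some (w.getD j 0) else none)

/-- The forgetful map: concatenate the blocks u*_{m-1} | … | u*_0. -/
def forget {m : ℕ} (P : Fin m → List (Fin m)) : List (Fin m) :=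
  (List.finRange m).reverse.flatMap P

/-- One pass of the inverse modular presweep algorithm, returning the removed letters
in removal order (i.e. w_N, w_{N-1}, …), or `none` upon hitting an empty block. -/
def invPresweepAux {m : ℕ} [NeZero m] :
    ℕ → (Fin m → List (Fin m)) → Fin m → Option (List (Fin m))
  | 0, _, _ => some []
  | n+1, P, l =>
    match P l with
    | [] => none
    | a :: rest => (invPresweepAux n (Function.update P l rest) (l - a)).map (fun ws => a :: ws)

/-- The inverse modular presweep map (Algorithm 2): starts at level |u| mod m. -/
def invPresweep {m : ℕ} [NeZero m] (N : ℕ) (P : Fin m → List (Fin m)) :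
    Option (List (Fin m)) :=
  (invPresweepAux N P ((forget P).sum)).map List.reverse

/-- The presweepResidual partitioned word left over when the inverse presweep algorithm stops. -/
def presweepResidual {m : ℕ} [NeZero m] :
    ℕ → (Fin m → List (Fin m)) → Fin m → (Fin m → List (Fin m))
  | 0, P, _ => P
  | n+1, P, l =>
    match P l with
    | [] => P
    | a :: rest => presweepResidual n (Function.update P l rest) (l - a)

/-- Sum of all letters of a partitioned word, as a natural number. -/
def totalSum {m : ℕ} (P : Fin m → List (Fin m)) : ℕ :=
  ∑ k : Fin m, ((P k).map Fin.val).sum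

/-- Number of filled cells in column `j` of the balancing array:
cell (letter a in block k, column j) is filled iff j ∈ {k, k+1, …, k+a-1} mod m. -/
def colCount {m : ℕ} [NeZero m] (P : Fin m → List (Fin m)) (j : Fin m) : ℕ :=
  ∑ k : Fin m, ((P k).filter (fun a => decide (((j - k : Fin m) : ℕ) < (a : ℕ)))).length

/-- The equitable number of filled cells for column `j`. -/
def eqCount {m : ℕ} [NeZero m] (P : Fin m → List (Fin m)) (j : Fin m) : ℕ :=
  if 1 ≤ (j : ℕ) ∧ (j : ℕ) ≤ totalSum P % m then totalSum P / m + 1 else totalSum P / m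

/-- A partitioned word is equitable if every column of its balancing array is equitably filled. -/
def Equitable {m : ℕ} [NeZero m] (P : Fin m → List (Fin m)) : Prop :=
  ∀ j : Fin m, colCount P j = eqCount P j

/-- The list recording, for each position of `forget P`, the index of the block containing it. -/
def blockList {m : ℕ} (P : Fin m → List (Fin m)) : List (Fin m) :=
  (List.finRange m).reverse.flatMap (fun k => (P k).map (fun _ => k))

/-- The index of the block containing the `i`-th letter (0-indexed) of `forget P`. -/
def blockIdx {m : ℕ} [NeZero m] (P : Fin m → List (Fin m)) (i : ℕ) : ℕ :=
  (((blockList P).getD i 0 : Fin m) : ℕ)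

/-- A balanced block-suffix of `P`: a suffix of each block, with letter sum ≡ 0 mod m. -/
def IsBBS {m : ℕ} [NeZero m] (P S : Fin m → List (Fin m)) : Prop :=
  (∀ k, S k <:+ P k) ∧ totalSum S % m = 0

/-- A left balanced block-suffix: a balanced block-suffix with empty rightmost block. -/
def IsLeftBBS {m : ℕ} [NeZero m] (P S : Fin m → List (Fin m)) : Prop :=
  IsBBS P S ∧ S 0 = []

/-- A minimal left balanced block-suffix: nonempty, and its intersection with any balanced
block-suffix is itself or empty. -/
def MinLeftBBS {m : ℕ} [NeZero m] (P S : Fin m → List (Fin m)) : Prop :=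
  IsLeftBBS P S ∧ (∃ k, S k ≠ []) ∧
  ∀ T, IsBBS P T → (∀ k, S k <:+ T k) ∨ (∀ k, S k = [] ∨ T k = [])

/-- Shift the letters of a left balanced block-suffix `S` of `P` one block to the right
(from block k to block k-1). -/
def shiftBy {m : ℕ} [NeZero m] (P S : Fin m → List (Fin m)) : Fin m → List (Fin m) :=
  fun k => S (k + 1) ++ (P k).take ((P k).length - (S k).length)

/-- One step of the rightmost-partition algorithm (Algorithm 4): with `j` the rightmost
(= smallest-index) column less than equitably filled, move the leftmost letter of block `j-1`
to the end of block `j`. -/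
def stepR {m : ℕ} [NeZero m] (P Q : Fin m → List (Fin m)) : Prop :=
  ∃ j : Fin m, colCount P j < eqCount P j ∧
    (∀ j' : Fin m, j' < j → eqCount P j' ≤ colCount P j') ∧
    Q = fun k => if k = j then P j ++ (P (j-1)).take 1
         else if k = j - 1 then (P (j-1)).tail else P k

/-- One step of the leftmost-partition algorithm (Algorithm 5): with `j` the leftmost
(= largest-index) column more than equitably filled, move the rightmost letter of block `j`
to the front of block `j-1`. -/
def stepL {m : ℕ} [NeZero m] (P Q : Fin m → List (Fin m)) : Prop :=
  ∃ j : Fin m, eqCount P j < colCount P j ∧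
    (∀ j' : Fin m, j < j' → colCount P j' ≤ eqCount P j') ∧
    Q = fun k => if k = j then (P j).dropLast
         else if k = j - 1 then (P j).drop ((P j).length - 1) ++ P k else P k

/-- The sum of all letters of a partitioned word in `Fin m`, i.e. |u| mod m. -/
def totalSumFin {m : ℕ} [NeZero m] (P : Fin m → List (Fin m)) : Fin m :=
  ∑ k : Fin m, (P k).sum

/-- Prepend the letter `i` to block `i + |u|_m` of `P`. -/
def addLetter {m : ℕ} [NeZero m] (P : Fin m → List (Fin m)) (i : Fin m) :
    Fin m → List (Fin m) :=
  fun k => if k = i + totalSumFin P then i :: P k else P k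

/-- The n-th level of the complete m-ary tree T*_m of partitioned words. -/
def TreeLevel (m : ℕ) [NeZero m] : ℕ → Set (Fin m → List (Fin m))
  | 0 => {fun _ => []}
  | n+1 => {Q | ∃ P ∈ TreeLevel m n, ∃ i : Fin m, Q = addLetter P i}

/-- The (integer) level of the `j`-th letter (0-indexed) of a word over ℤ. -/
def zlevel (w : List ℤ) (j : ℕ) : ℤ :=
  (w.take (j+1)).sum

/-- The sequence of levels swept: k = -1, -2, …, then …, 2, 1, 0. -/
def sweepKeys (w : List ℤ) : List ℤ :=
  ((List.range ((w.map Int.natAbs).sum)).map (fun t => -((t : ℤ)+1))) ++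
  ((List.range ((w.map Int.natAbs).sum + 1)).reverse.map (fun t => (t : ℤ)))

/-- The sweep map on words over ℤ. -/
def zsweep (w : List ℤ) : List ℤ :=
  (sweepKeys w).flatMap (fun k =>
    ((List.range w.length).reverse).filterMap (fun j =>
      if zlevel w j = k then some (w.getD j 0) else none))

/-- The set A_ℤ of words containing exactly `e j` copies of `a j` for each `j`. -/
def AZ (n : ℕ) (a : Fin n → ℤ) (e : Fin n → ℕ) : Set (List ℤ) :=
  {w | (w : Multiset ℤ) = ∑ j : Fin n, Multiset.replicate (e j) (a j)}

/-- The set A_ℕ of Dyck words: words of A_ℤ with all levels nonnegative. -/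
def ANset (n : ℕ) (a : Fin n → ℤ) (e : Fin n → ℕ) : Set (List ℤ) :=
  {w | w ∈ AZ n a e ∧ ∀ j < w.length, 0 ≤ zlevel w j}

/-- The sequence of levels for the zeta map: k = 0, 1, 2, …, then …, -3, -2, -1. -/
def zetaKeys (w : List ℤ) : List ℤ :=
  ((List.range ((w.map Int.natAbs).sum + 1)).map (fun t => (t : ℤ))) ++
  ((List.range ((w.map Int.natAbs).sum)).reverse.map (fun t => -((t : ℤ)+1)))

/-- The zeta map: sort the letters of `w` by level, reading left-to-right, for
k = 0,1,2,… and then k = …,-3,-2,-1. -/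
def zeta (w : List ℤ) : List ℤ :=
  (zetaKeys w).flatMap (fun k =>
    (List.range w.length).filterMap (fun j =>
      if zlevel w j = k then some (w.getD j 0) else none))

/-- The set of rational Dyck words: -b copies of a, a copies of b, all partial sums ≥ 0. -/
def Dab (a b : ℤ) : Set (List ℤ) :=
  {w | (w : Multiset ℤ) = Multiset.replicate (-b).toNat a + Multiset.replicate a.toNat b ∧
       ∀ j < w.length, 0 ≤ zlevel w j}

/-- Indicator that the cyclic interval of `a` columns starting at `k` contains column `c`. -/
def cellInd (m : ℕ) (a k c : ℤ) : ℤ := if (c - k) % m < a then 1 else 0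

/-- Indicator of congruence modulo `m`. -/
def congInd (m : ℕ) (c x : ℤ) : ℤ := if (c - x) % m = 0 then 1 else 0

/-- Number of intervals `[p i, p i + u i)` which cover column `c` modulo `m`. -/
def fillCount {ι : Type*} [Fintype ι] (m : ℕ) (u p : ι → ℤ) (c : ℤ) : ℤ :=
  ∑ i, cellInd m (u i) (p i) c

lemma cellInd_add_one (m : ℕ) (a k c : ℤ) : cellInd m a (k + 1) c = cellInd m a k (c - 1) := by
  unfold cellInd; congr 3; ring

lemma cellInd_sub_cellInd {m : ℕ} {a : ℤ} (ha : 0 ≤ a) (ham : a < m) (k c : ℤ) :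
    cellInd m a k c - cellInd m a k (c - 1) = congInd m c k - congInd m c (k + a) := by
  unfold cellInd congInd
  have e1 : c - 1 - k = (c - k) - 1 := by ring
  have e2 : c - (k + a) = (c - k) - a := by ring
  rw [e1, e2]
  generalize c - k = x
  have hm : (0 : ℤ) < m := by omega
  obtain ⟨r, hr⟩ : ∃ r, r = x % m := ⟨_, rfl⟩
  have h0 : 0 ≤ r := hr ▸ Int.emod_nonneg _ hm.ne'
  have h1 : r < m := hr ▸ Int.emod_lt_of_pos _ hm
  have h2 : (x - 1) % m = if r = 0 then (m : ℤ) - 1 else r - 1 := by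
    rw [← Int.emod_sub_emod, ← hr]
    split_ifs with h
    · rw [h, ← Int.add_emod_right, Int.emod_eq_of_lt] <;> omega
    · rw [Int.emod_eq_of_lt] <;> omega
  have h3 : (x - a) % m = if r < a then r - a + m else r - a := by
    rw [← Int.emod_sub_emod, ← hr]
    split_ifs with h
    · rw [← Int.add_emod_right, Int.emod_eq_of_lt] <;> omega
    · rw [Int.emod_eq_of_lt] <;> omega
  rw [h2, h3, ← hr]
  split_ifs <;> omega

lemma sum_mul_congInd {m : ℕ} (hm : 0 < m) (f : ℤ → ℤ) (x : ℤ) :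
    ∑ c ∈ Finset.Ico (0 : ℤ) m, f c * congInd m c x = f (x % m) := by
  have hm' : (0 : ℤ) < m := by exact_mod_cast hm
  have h0 := Int.emod_nonneg x hm'.ne'
  have h1 := Int.emod_lt_of_pos x hm'
  rw [Finset.sum_eq_single (x % m)]
  · simp [congInd]
  · intro b hb hne
    rw [Finset.mem_Ico] at hb
    have : ¬ (b - x) % m = 0 := by
      intro h
      rw [← Int.emod_eq_emod_iff_emod_sub_eq_zero, Int.emod_eq_of_lt hb.1 hb.2] at h
      exact hne h
    simp [congInd, this]
  · intro h
    exact absurd (Finset.mem_Ico.2 ⟨h0, h1⟩) h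

lemma sum_congInd {m : ℕ} (hm : 0 < m) (x : ℤ) :
    ∑ c ∈ Finset.Ico (0 : ℤ) m, congInd m c x = 1 := by
  simpa using sum_mul_congInd hm (fun _ => 1) x

lemma sum_cellInd {m : ℕ} {a : ℤ} (ha : 0 ≤ a) (ham : a < m) (k l : ℤ) :
    ∑ c ∈ Finset.Ico (0 : ℤ) m, cellInd m a k c = ∑ c ∈ Finset.Ico (0 : ℤ) m, cellInd m a l c := by
  have hm : 0 < m := by omega
  have step (k : ℤ) : ∑ c ∈ Finset.Ico (0 : ℤ) m, cellInd m a (k + 1) c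
      = ∑ c ∈ Finset.Ico (0 : ℤ) m, cellInd m a k c := by
    have : ∑ c ∈ Finset.Ico (0 : ℤ) m, (cellInd m a k c - cellInd m a (k + 1) c) = 0 := by
      simp_rw [cellInd_add_one, cellInd_sub_cellInd ha ham]
      rw [Finset.sum_sub_distrib, sum_congInd hm, sum_congInd hm, sub_self]
    rw [Finset.sum_sub_distrib] at this
    linarith
  have key (k : ℤ) : ∑ c ∈ Finset.Ico (0 : ℤ) m, cellInd m a k c
      = ∑ c ∈ Finset.Ico (0 : ℤ) m, cellInd m a 0 c := by
    induction k using Int.induction_on with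
    | zero => rfl
    | succ i ih => rw [step, ih]
    | pred i ih => rw [← ih, ← step, sub_add_cancel]
  rw [key k, key l]

lemma cellInd_mono {m : ℕ} {a k l c : ℤ} (hkl : k ≤ l) (hiff : c < k ↔ c < l)
    (hk : c - m < k) (hl : l ≤ c + m) : cellInd m a k c ≤ cellInd m a l c := by
  have h : (c - l) % m ≤ (c - k) % m := by
    by_cases h : c < k
    · have h' := hiff.1 h
      rw [← Int.add_emod_right (c - l), ← Int.add_emod_right (c - k),
        Int.emod_eq_of_lt, Int.emod_eq_of_lt] <;> omega
    · have h' := fun h' => h (hiff.2 h')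
      rw [Int.emod_eq_of_lt, Int.emod_eq_of_lt] <;> omega
  unfold cellInd
  split_ifs <;> omega

lemma dvd_sum_of_sum_congInd_eq {ι : Type*} {m : ℕ} (hm : 0 < m) {u p : ι → ℤ} {S : Finset ι}
    (h : ∀ c : ℤ, 0 ≤ c → c < m →
      ∑ i ∈ S, congInd m c (p i) = ∑ i ∈ S, congInd m c (p i + u i)) :
    (m : ℤ) ∣ ∑ i ∈ S, u i := by
  have h1 : ∑ i ∈ S, p i % m = ∑ i ∈ S, (p i + u i) % m := by
    have e (x : ι → ℤ) : ∑ i ∈ S, x i % m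
        = ∑ c ∈ Finset.Ico (0 : ℤ) m, c * ∑ i ∈ S, congInd m c (x i) := by
      simp_rw [Finset.mul_sum]
      rw [Finset.sum_comm]
      exact Finset.sum_congr rfl fun i _ => (sum_mul_congInd hm (fun c => c) _).symm
    rw [e, e]
    refine Finset.sum_congr rfl fun c hc => ?_
    rw [h c (Finset.mem_Ico.1 hc).1 (Finset.mem_Ico.1 hc).2]
  have h2 := congrArg (· % (m : ℤ)) h1
  simp only [← Finset.sum_int_mod] at h2
  rw [Finset.sum_add_distrib] at h2
  simpa using Int.ModEq.dvd h2

section Fill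

variable {ι : Type*} [Fintype ι] {m : ℕ} {u : ι → ℤ}

lemma sum_fillCount (hu : ∀ i, 0 ≤ u i) (hum : ∀ i, u i < m) (p q : ι → ℤ) :
    ∑ c ∈ Finset.Ico (0 : ℤ) m, fillCount m u p c
      = ∑ c ∈ Finset.Ico (0 : ℤ) m, fillCount m u q c := by
  unfold fillCount
  rw [Finset.sum_comm, Finset.sum_comm (s := Finset.Ico (0 : ℤ) m)]
  exact Finset.sum_congr rfl fun i _ => sum_cellInd (hu i) (hum i) _ _

lemma fillCount_eq_of_le (hu : ∀ i, 0 ≤ u i) (hum : ∀ i, u i < m) {p q : ι → ℤ}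
    (h : ∀ c : ℤ, 0 ≤ c → c < m → fillCount m u p c ≤ fillCount m u q c) :
    ∀ c : ℤ, 0 ≤ c → c < m → fillCount m u p c = fillCount m u q c := by
  have := (Finset.sum_eq_sum_iff_of_le (s := Finset.Ico (0 : ℤ) m)
    (f := fillCount m u p) (g := fillCount m u q)
    (fun c hc => h c (Finset.mem_Ico.1 hc).1 (Finset.mem_Ico.1 hc).2)).1
    (sum_fillCount hu hum p q)
  exact fun c h0 h1 => this c (Finset.mem_Ico.2 ⟨h0, h1⟩)

/-- If one of the two weakly decreasing sequences has fewer terms above the threshold `c`, then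
their pointwise minimum has the same terms above the threshold as that sequence. -/
lemma lt_min_iff_or [LinearOrder ι] {p q : ι → ℤ} (hp : Antitone p) (hq : Antitone q) (c : ℤ) :
    (∀ i, c < min (p i) (q i) ↔ c < p i) ∨ (∀ i, c < min (p i) (q i) ↔ c < q i) := by
  by_contra! h
  obtain ⟨⟨i, hi⟩, ⟨k, hk⟩⟩ := h
  have := le_total i k
  rcases this with h | h
  · have := hp h; have := hq h; omega
  · have := hp h; have := hq h; omega

lemma fillCount_min_le [LinearOrder ι] {p q : ι → ℤ} (hp : Antitone p) (hq : Antitone q)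
    (hp0 : ∀ i, 0 ≤ p i) (hpm : ∀ i, p i ≤ m) (hq0 : ∀ i, 0 ≤ q i) (hqm : ∀ i, q i ≤ m)
    {c : ℤ} (hc0 : 0 ≤ c) (hcm : c < m) :
    fillCount m u (fun i => min (p i) (q i)) c ≤ fillCount m u p c ∨
      fillCount m u (fun i => min (p i) (q i)) c ≤ fillCount m u q c := by
  refine (lt_min_iff_or hp hq c).imp (fun h => ?_) (fun h => ?_) <;>
  · refine Finset.sum_le_sum fun i _ => cellInd_mono (by simp) (h i) ?_ ?_ <;>
    · have := hp0 i; have := hpm i; have := hq0 i; have := hqm i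
      grind

lemma fillCount_sub_fillCount (hu : ∀ i, 0 ≤ u i) (hum : ∀ i, u i < m) (p : ι → ℤ) (c : ℤ) :
    fillCount m u p c - fillCount m u p (c - 1)
      = ∑ i, congInd m c (p i) - ∑ i, congInd m c (p i + u i) := by
  unfold fillCount
  rw [← Finset.sum_sub_distrib, ← Finset.sum_sub_distrib]
  exact Finset.sum_congr rfl fun i _ => cellInd_sub_cellInd (hu i) (hum i) _ _

/-- Raising by one all the terms where two comparable sequences with equal column counts differ
either produces a set of terms with sum divisible by `m`, or overfills the last column. -/
lemma exists_congr_of_lt [LinearOrder ι] (hu : ∀ i, 0 ≤ u i) (hum : ∀ i, u i < m) {s : ℤ}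
    {p q : ι → ℤ} (hp : Antitone p) (hq : Antitone q) (hpq : ∀ i, p i ≤ q i)
    (hp0 : ∀ i, 0 ≤ p i) (hqm : ∀ i, q i < m)
    (hfill : ∀ c : ℤ, 0 ≤ c → c < m → fillCount m u p c = fillCount m u q c)
    (hstep : ∀ c : ℤ, 0 ≤ c → c < m →
      fillCount m u p c - fillCount m u p (c - 1) = congInd m c 1 - congInd m c (1 + s))
    (hsum : ¬ (m : ℤ) ∣ ∑ i with p i < q i, u i) :
    ¬ (m : ℤ) ∣ s ∧ ∃ i, p i < q i ∧ (m : ℤ) ∣ p i + u i - (1 + s) := by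
  have hm : 0 < m := by
    rcases Nat.eq_zero_or_pos m with rfl | h
    · exfalso; apply hsum
      rw [Finset.sum_eq_zero]
      · simp
      · intro i; have := hu i; have := hum i; push_cast at this; omega
    · exact h
  set r : ι → ℤ := fun i => min (p i + 1) (q i) with hr
  have hdiff (c : ℤ) : fillCount m u p c - fillCount m u r c
      = ∑ i with p i < q i, congInd m c (p i) - ∑ i with p i < q i, congInd m c (p i + u i) := by
    unfold fillCount
    rw [← Finset.sum_sub_distrib, ← Finset.sum_sub_distrib, Finset.sum_filter]
    refine Finset.sum_congr rfl fun i _ => ?_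
    have := hpq i
    split_ifs with h
    · have : r i = p i + 1 := by simp only [hr]; omega
      rw [this, cellInd_add_one, cellInd_sub_cellInd (hu i) (hum i)]
    · have : r i = p i := by simp only [hr]; omega
      rw [this, sub_self]
  obtain ⟨c, hc0, hcm, hc⟩ : ∃ c : ℤ, 0 ≤ c ∧ c < m ∧ fillCount m u p c < fillCount m u r c := by
    by_contra! h
    refine hsum (dvd_sum_of_sum_congInd_eq (p := p) hm fun c hc0 hcm => ?_)
    have := hdiff c
    rw [fillCount_eq_of_le hu hum h c hc0 hcm, sub_self] at this
    linarith
  have hle : fillCount m u r c ≤ fillCount m u p (c - 1) := by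
    rcases fillCount_min_le (u := u) (p := fun i => p i + 1) (q := q) (m := m)
      (fun i j h => by simpa using hp h) hq (fun i => by have := hp0 i; omega)
      (fun i => by have := hpq i; have := hqm i; omega)
      (fun i => (hp0 i).trans (hpq i)) (fun i => (hqm i).le) hc0 hcm with h | h
    · refine h.trans_eq ?_
      simp only [fillCount, cellInd_add_one]
    · rw [← hfill c hc0 hcm] at h
      exact absurd h (not_le.2 hc)
  have hs := hstep c hc0 hcm
  have h1 : (m : ℤ) ∣ c - (1 + s) ∧ ¬ (m : ℤ) ∣ c - 1 := by
    rw [Int.dvd_iff_emod_eq_zero, Int.dvd_iff_emod_eq_zero]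
    unfold congInd at hs
    split_ifs at hs <;> omega
  refine ⟨fun hd => h1.2 (by simpa [← sub_sub] using dvd_add h1.1 hd), ?_⟩
  by_contra! hcon
  have h2 : ∑ i with p i < q i, congInd m c (p i + u i) = 0 := by
    refine Finset.sum_eq_zero fun i hi => ?_
    rw [congInd, if_neg]
    rw [← Int.dvd_iff_emod_eq_zero]
    intro hd
    apply hcon i (by simpa using hi)
    simpa only [sub_sub_sub_cancel_left] using dvd_sub h1.1 hd
  have h3 : 0 ≤ ∑ i with p i < q i, congInd m c (p i) :=
    Finset.sum_nonneg fun i _ => by unfold congInd; split_ifs <;> simp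
  have := hdiff c
  omega

/-- If every step `p i → p i + u i` is followed by another one modulo `m`, then some nonempty set
of steps closes up. -/
lemma exists_dvd_sum_of_forall_exists [Nonempty ι] {p : ι → ℤ}
    (h : ∀ i, ∃ k, (m : ℤ) ∣ p k - (p i + u i)) :
    ∃ S : Finset ι, S.Nonempty ∧ (m : ℤ) ∣ ∑ i ∈ S, u i := by
  classical
  choose f hf using h
  refine ⟨(Function.periodicPts f).toFinset, ?_, ?_⟩
  · obtain ⟨x⟩ := ‹Nonempty ι›
    obtain ⟨a, b, hab, h⟩ := Finite.exists_ne_map_eq_of_infinite (fun n : ℕ => f^[n] x)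
    wlog hlt : a < b generalizing a b
    · exact this b a hab.symm h.symm (by omega)
    refine ⟨f^[a] x, ?_⟩
    rw [Set.mem_toFinset]
    refine ⟨b - a, by omega, ?_⟩
    rw [Function.IsPeriodicPt, Function.IsFixedPt, ← Function.iterate_add_apply,
      Nat.sub_add_cancel hlt.le]
    exact h.symm
  · have hb := Function.bijOn_periodicPts f
    have h1 : ∑ i ∈ (Function.periodicPts f).toFinset, p (f i)
        = ∑ i ∈ (Function.periodicPts f).toFinset, p i := by
      refine Finset.sum_bij (fun i _ => f i) ?_ ?_ ?_ ?_
      · intro i hi; rw [Set.mem_toFinset] at hi ⊢; exact hb.mapsTo hi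
      · intro i hi k hk h; rw [Set.mem_toFinset] at hi hk; exact hb.injOn hi hk h
      · intro i hi; rw [Set.mem_toFinset] at hi
        obtain ⟨k, hk, hki⟩ := hb.surjOn hi
        exact ⟨k, by rwa [Set.mem_toFinset], hki⟩
      · intros; rfl
    have h2 : (m : ℤ) ∣ ∑ i ∈ (Function.periodicPts f).toFinset, (p (f i) - (p i + u i)) :=
      Finset.dvd_sum fun i _ => hf i
    rw [Finset.sum_sub_distrib, Finset.sum_add_distrib, h1] at h2
    simpa using h2

theorem le_or_le_of_fillCount_eq [LinearOrder ι] (hu : ∀ i, 0 ≤ u i) (hum : ∀ i, u i < m)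
    (hsub : ∀ S : Finset ι, (m : ℤ) ∣ ∑ i ∈ S, u i → S = ∅ ∨ S = Finset.univ)
    {p q : ι → ℤ} (hp : Antitone p) (hq : Antitone q)
    (hp0 : ∀ i, 0 ≤ p i) (hpm : ∀ i, p i < m) (hq0 : ∀ i, 0 ≤ q i) (hqm : ∀ i, q i < m)
    (hfill : ∀ c : ℤ, 0 ≤ c → c < m → fillCount m u p c = fillCount m u q c)
    (hstep : ∀ c : ℤ, 0 ≤ c → c < m →
      fillCount m u p c - fillCount m u p (c - 1)
        = congInd m c 1 - congInd m c (1 + ∑ i, u i)) :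
    (∀ i, p i ≤ q i) ∨ (∀ i, q i ≤ p i) := by
  by_contra! h
  obtain ⟨⟨x, hx⟩, ⟨y, hy⟩⟩ := h
  set r : ι → ℤ := fun i => min (p i) (q i) with hr
  have hrp : ∀ c : ℤ, 0 ≤ c → c < m → fillCount m u r c = fillCount m u p c := by
    refine fillCount_eq_of_le hu hum fun c hc0 hcm => ?_
    rcases fillCount_min_le (u := u) hp hq hp0 (fun i => (hpm i).le) hq0 (fun i => (hqm i).le)
      hc0 hcm with h | h
    · exact h
    · exact h.trans_eq (hfill c hc0 hcm).symm
  have hm : (0 : ℤ) < m := (hp0 x).trans_lt (hpm x)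
  have hper (v : ι → ℤ) : fillCount m u v (0 - 1) = fillCount m u v (m - 1) := by
    unfold fillCount cellInd
    refine Finset.sum_congr rfl fun i _ => ?_
    rw [show (m : ℤ) - 1 - v i = 0 - 1 - v i + m by ring, Int.add_emod_right]
  have hrstep : ∀ c : ℤ, 0 ≤ c → c < m → fillCount m u r c - fillCount m u r (c - 1)
      = congInd m c 1 - congInd m c (1 + ∑ i, u i) := by
    intro c hc0 hcm
    rw [← hstep c hc0 hcm, hrp c hc0 hcm]
    rcases hc0.eq_or_lt with rfl | hc
    · rw [hper, hper, hrp] <;> omega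
    · rw [hrp (c - 1)] <;> omega
  have hra : Antitone r := fun i k h => min_le_min (hp h) (hq h)
  have hr0 : ∀ i, 0 ≤ r i := fun i => le_min (hp0 i) (hq0 i)
  obtain ⟨hs, i, hi, hi'⟩ := exists_congr_of_lt hu hum hra hp (fun i => min_le_left _ _) hr0 hpm
    hrp hrstep (by
      intro hd
      rcases hsub _ hd with h | h
      · have : x ∈ (Finset.univ.filter fun i => r i < p i) := by simp [hr, hx]
        simp [h] at this
      · have : y ∈ (Finset.univ.filter fun i => r i < p i) := by simp [h]
        simp [hr] at this
        omega)
  obtain ⟨-, k, hk, hk'⟩ := exists_congr_of_lt hu hum hra hq (fun i => min_le_right _ _) hr0 hqm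
    (fun c h0 h1 => (hrp c h0 h1).trans (hfill c h0 h1)) hrstep (by
      intro hd
      rcases hsub _ hd with h | h
      · have : y ∈ (Finset.univ.filter fun i => r i < q i) := by simp [hr, hy]
        simp [h] at this
      · have : x ∈ (Finset.univ.filter fun i => r i < q i) := by simp [h]
        simp [hr] at this
        omega)
  have hik : i ≠ k := by
    rintro rfl
    simp only [hr] at hi hk
    omega
  have : Nonempty ι := ⟨x⟩
  obtain ⟨S, hS, hSd⟩ := exists_dvd_sum_of_forall_exists (m := m) (u := u) (p := r) (by
    intro l
    by_contra! hcon
    set c := (r l + u l) % m with hc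
    have hc0 : 0 ≤ c := Int.emod_nonneg _ hm.ne'
    have hcm : c < m := Int.emod_lt_of_pos _ hm
    have hcd : (m : ℤ) ∣ c - (r l + u l) := by
      rw [hc, Int.emod_def]; exact ⟨-((r l + u l) / m), by ring⟩
    have hout : ∑ j, congInd m c (r j) = 0 := by
      refine Finset.sum_eq_zero fun j _ => ?_
      rw [congInd, if_neg]
      rw [← Int.dvd_iff_emod_eq_zero]
      intro hd
      exact hcon j (by simpa only [sub_sub_sub_cancel_left] using dvd_sub hcd hd)
    have hst := hrstep c hc0 hcm
    rw [fillCount_sub_fillCount hu hum, hout] at hst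
    have hnn (x : ℤ) : 0 ≤ congInd m c x := by unfold congInd; split_ifs <;> simp
    have hone {x : ℤ} (h : (m : ℤ) ∣ c - x) : congInd m c x = 1 := by
      rw [congInd, if_pos (Int.emod_eq_zero_of_dvd h)]
    have h1 := hnn 1
    by_cases hcs : (m : ℤ) ∣ c - (1 + ∑ i, u i)
    · have h2 : ∑ j ∈ {i, k}, congInd m c (r j + u j) ≤ ∑ j, congInd m c (r j + u j) :=
        Finset.sum_le_sum_of_subset_of_nonneg (Finset.subset_univ _) fun j _ _ => hnn _
      have hone' {j : ι} (h : (m : ℤ) ∣ r j + u j - (1 + ∑ i, u i)) :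
          congInd m c (r j + u j) = 1 :=
        hone (by simpa only [sub_sub_sub_cancel_right] using dvd_sub hcs h)
      rw [Finset.sum_pair hik, hone' hi', hone' hk'] at h2
      rw [hone hcs] at hst
      omega
    · have h2 : congInd m c (r l + u l) ≤ ∑ j, congInd m c (r j + u j) :=
        Finset.single_le_sum (f := fun j => congInd m c (r j + u j)) (fun j _ => hnn _)
          (Finset.mem_univ l)
      rw [hone hcd] at h2
      have h3 : congInd m c (1 + ∑ i, u i) = 0 := by
        rw [congInd, if_neg]
        rwa [← Int.dvd_iff_emod_eq_zero]
      omega)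
  rcases hsub S hSd with h | h
  · exact hS.ne_empty h
  · exact hs (h ▸ hSd)

end Fill

/-- The letters of `forget P`, each paired with the index of its block. -/
def labelled {m : ℕ} (P : Fin m → List (Fin m)) : List (Fin m × Fin m) :=
  (List.finRange m).reverse.flatMap fun k => (P k).map (Prod.mk k)

lemma map_fst_labelled {m : ℕ} (P : Fin m → List (Fin m)) :
    (labelled P).map Prod.fst = blockList P := by
  simp [labelled, blockList, List.map_flatMap, Function.comp_def]

lemma map_snd_labelled {m : ℕ} (P : Fin m → List (Fin m)) :
    (labelled P).map Prod.snd = forget P := by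
  simp [labelled, forget, List.map_flatMap, Function.comp_def]

lemma length_blockList {m : ℕ} (P : Fin m → List (Fin m)) :
    (blockList P).length = (forget P).length := by
  rw [← map_fst_labelled, ← map_snd_labelled, List.length_map, List.length_map]

lemma pairwise_blockList {m : ℕ} (P : Fin m → List (Fin m)) :
    (blockList P).Pairwise (· ≥ ·) := by
  rw [blockList, List.pairwise_flatMap]
  constructor
  · intro k _
    rw [List.pairwise_map]
    exact List.pairwise_of_forall fun _ _ => le_rfl
  · rw [List.pairwise_reverse]
    refine (List.pairwise_lt_finRange m).imp fun h x hx y hy => ?_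
    simp only [List.mem_map] at hx hy
    obtain ⟨_, _, rfl⟩ := hx
    obtain ⟨_, _, rfl⟩ := hy
    exact h.le

lemma sum_flatMap_reverse_finRange {m : ℕ} {α : Type*} (P : Fin m → List α) (f : α → ℕ) :
    (((List.finRange m).reverse.flatMap P).map f).sum = ∑ k, ((P k).map f).sum := by
  rw [Fin.sum_univ_def, ← List.sum_reverse ((List.finRange m).map _), ← List.map_reverse]
  induction (List.finRange m).reverse with
  | nil => simp
  | cons a l ih => simp [ih]

lemma totalSum_eq_sum_forget {m : ℕ} (P : Fin m → List (Fin m)) :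
    totalSum P = ((forget P).map Fin.val).sum :=
  (sum_flatMap_reverse_finRange P _).symm

lemma colCount_eq_sum_labelled {m : ℕ} [NeZero m] (P : Fin m → List (Fin m)) (j : Fin m) :
    colCount P j = ((labelled P).map fun x =>
      if ((j - x.1 : Fin m) : ℕ) < (x.2 : ℕ) then 1 else 0).sum := by
  rw [labelled, sum_flatMap_reverse_finRange, colCount]
  refine Finset.sum_congr rfl fun k _ => ?_
  induction P k with
  | nil => rfl
  | cons a l ih =>
    by_cases h : ((j - k : Fin m) : ℕ) < (a : ℕ) <;> simp_all [add_comm]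

lemma val_sub_eq_emod {m : ℕ} (j k : Fin m) : (((j - k : Fin m) : ℕ) : ℤ) = ((j : ℤ) - k) % m := by
  rw [Fin.sub_def]
  push_cast [Nat.cast_sub k.2.le]
  rw [← Int.add_emod_right ((j : ℤ) - k)]
  congr 1; ring

lemma blockIdx_eq {m : ℕ} [NeZero m] (P : Fin m → List (Fin m)) {i : ℕ}
    (hi : i < (blockList P).length) : blockIdx P i = ((blockList P)[i] : ℕ) := by
  rw [blockIdx, List.getD_eq_getElem _ _ hi]

lemma colCount_eq_fillCount {m : ℕ} [NeZero m] {P : Fin m → List (Fin m)} {u : List (Fin m)}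
    (hP : forget P = u) (j : Fin m) :
    (colCount P j : ℤ) = fillCount m (fun i : Fin u.length => ((u[i] : Fin m) : ℤ))
      (fun i => (blockIdx P i : ℤ)) (j : ℤ) := by
  subst hP
  have hl : (labelled P).length = (forget P).length := by
    rw [← map_snd_labelled, List.length_map]
  rw [colCount_eq_sum_labelled, ← Fin.sum_univ_fun_getElem, fillCount, Nat.cast_sum]
  refine Fintype.sum_equiv (finCongr hl) _ _ fun i => ?_
  have h1 : blockIdx P (i : ℕ) = ((labelled P)[i].1 : ℕ) := by
    rw [blockIdx_eq _ (by rw [length_blockList, ← hl]; exact i.2)]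
    simp only [← map_fst_labelled, List.getElem_map]
    rfl
  have h2 : ((forget P)[finCongr hl i] : Fin m) = (labelled P)[i].2 := by
    simp only [← map_snd_labelled, Fin.getElem_fin, List.getElem_map]
    rfl
  rw [h2, cellInd]
  simp only [finCongr_apply, Fin.val_cast, h1, ← val_sub_eq_emod, Nat.cast_lt]
  push_cast
  rfl

lemma antitone_blockIdx {m : ℕ} [NeZero m] {P : Fin m → List (Fin m)} {u : List (Fin m)}
    (hP : forget P = u) : Antitone fun i : Fin u.length => (blockIdx P i : ℤ) := by
  subst hP
  intro i k hik
  have hi : (i : ℕ) < (blockList P).length := by rw [length_blockList]; exact i.2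
  have hk : (k : ℕ) < (blockList P).length := by rw [length_blockList]; exact k.2
  simp only [blockIdx_eq _ hi, blockIdx_eq _ hk, Nat.cast_le, Fin.val_fin_le]
  rcases hik.eq_or_lt with rfl | h
  · rfl
  · exact List.pairwise_iff_getElem.1 (pairwise_blockList P) _ _ hi hk h

/-- The column counts of an equitable partition jump up after column `0` and down after
column `|u| mod m`. -/
lemma fillCount_sub_of_equitable {m : ℕ} [NeZero m] {P : Fin m → List (Fin m)}
    {u : List (Fin m)} (hP : forget P = u) (he : Equitable P) {c : ℤ} (hc0 : 0 ≤ c)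
    (hcm : c < m) :
    let v := fun i : Fin u.length => ((u[i] : Fin m) : ℤ)
    let p := fun i : Fin u.length => (blockIdx P i : ℤ)
    fillCount m v p c - fillCount m v p (c - 1)
      = congInd m c 1 - congInd m c (1 + ∑ i, v i) := by
  intro v p
  have hm : (0 : ℤ) < m := by omega
  have hsum : ∑ i, v i = (totalSum P : ℤ) := by
    rw [totalSum_eq_sum_forget, hP, ← Fin.sum_univ_fun_getElem]
    push_cast
    rfl
  set d : ℤ := ((totalSum P / m : ℕ) : ℤ)
  obtain ⟨t, ht⟩ : ∃ t : ℤ, t = ((totalSum P % m : ℕ) : ℤ) := ⟨_, rfl⟩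
  have hval (b : ℤ) (h0 : 0 ≤ b) (h1 : b < m) :
      fillCount m v p b = if 1 ≤ b ∧ b ≤ t then d + 1 else d := by
    lift b to ℕ using h0
    have hb : b < m := by omega
    rw [← colCount_eq_fillCount hP ⟨b, hb⟩, he, eqCount]
    subst ht
    norm_cast
    simp only []
    split_ifs <;> rfl
  have ht0 : 0 ≤ t := by omega
  have htm : t < m := by rw [ht]; exact_mod_cast Nat.mod_lt _ (by omega)
  have hprev : fillCount m v p (c - 1) = if 2 ≤ c ∧ c ≤ t + 1 ∨ c = 0 ∧ t = m - 1 ∧ 2 ≤ m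
      then d + 1 else d := by
    rcases hc0.eq_or_lt with rfl | hc
    · have : fillCount m v p (0 - 1) = fillCount m v p (m - 1) := by
        unfold fillCount cellInd
        refine Finset.sum_congr rfl fun i _ => ?_
        rw [show (m : ℤ) - 1 - p i = 0 - 1 - p i + m by ring, Int.add_emod_right]
      rw [this, hval _ (by omega) (by omega)]
      split_ifs <;> omega
    · rw [hval _ (by omega) (by omega)]
      split_ifs <;> omega
  have hs : congInd m c (1 + ∑ i, v i) = if c = t + 1 ∨ c = 0 ∧ t = m - 1 then 1 else 0 := by
    have : (c - (1 + ∑ i, v i)) % m = (c - (1 + t)) % m := by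
      rw [hsum, ht]; push_cast
      rw [← sub_sub, ← sub_sub, Int.sub_emod_emod]
    rw [congInd, this]
    refine if_congr ?_ rfl rfl
    rw [← Int.dvd_iff_emod_eq_zero]
    constructor
    · rintro ⟨z, hz⟩
      have h1 : z < 1 := by nlinarith
      have h2 : -2 < z := by nlinarith
      interval_cases z <;> omega
    · rintro (h | ⟨h, h'⟩)
      · exact ⟨0, by omega⟩
      · exact ⟨-1, by omega⟩
  have h1 : congInd m c 1 = if c = 1 ∨ c = 0 ∧ m = 1 then 1 else 0 := by
    rw [congInd]
    refine if_congr ?_ rfl rfl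
    rw [← Int.dvd_iff_emod_eq_zero]
    constructor
    · rintro ⟨z, hz⟩
      have h1 : z < 1 := by nlinarith
      have h2 : -2 < z := by nlinarith
      interval_cases z <;> omega
    · rintro (h | ⟨h, h'⟩)
      · exact ⟨0, by omega⟩
      · exact ⟨-1, by omega⟩
  rw [hval c hc0 hcm, hprev, hs, h1]
  split_ifs <;> omega

lemma eq_empty_or_univ_of_dvd_sum {m : ℕ} {u : List (Fin m)}
    (hsub : ∀ S : Multiset (Fin m), S ≤ (u : Multiset (Fin m)) →
      (S.map Fin.val).sum % m = 0 → S = 0 ∨ S = (u : Multiset (Fin m)))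
    (S : Finset (Fin u.length)) (hS : (m : ℤ) ∣ ∑ i ∈ S, ((u[i] : Fin m) : ℤ)) :
    S = ∅ ∨ S = Finset.univ := by
  have hu : (u : Multiset (Fin m)) = (Finset.univ : Finset (Fin u.length)).val.map (u[·]) := by
    rw [Fin.univ_val_map]
    simp
  have hle : S.val.map (u[·]) ≤ (u : Multiset (Fin m)) := by
    rw [hu]
    exact Multiset.map_le_map (Finset.val_le_iff.2 (Finset.subset_univ S))
  have hdvd : ((S.val.map (u[·])).map Fin.val).sum % m = 0 := by
    rw [Multiset.map_map]
    apply Nat.mod_eq_zero_of_dvd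
    exact_mod_cast hS
  rcases hsub _ hle hdvd with h | h
  · left
    simpa using h
  · right
    rw [hu] at h
    have := congrArg Multiset.card h
    rw [Multiset.card_map, Multiset.card_map] at this
    exact (Finset.card_eq_iff_eq_univ S).1 (by simpa using this)

lemma eq_of_suffix_of_length_forget_eq {m : ℕ} {P S : Fin m → List (Fin m)}
    (h : ∀ k, S k <:+ P k) (hl : (forget S).length = (forget P).length) : S = P := by
  have e (Q : Fin m → List (Fin m)) : (forget Q).length = ∑ k, (Q k).length := by
    have := sum_flatMap_reverse_finRange Q (fun _ => 1)
    simpa [forget] using this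
  rw [e, e, Finset.sum_eq_sum_iff_of_le fun k _ => (h k).length_le] at hl
  exact funext fun k => (h k).eq_of_length (hl k (Finset.mem_univ k))

/-- If no proper nonempty sub-multiset of the letters of u sums to 0 mod m,
then every nonempty balanced block-suffix of an equitable partition of u is the whole
partitioned word, and the componentwise order on equitable partitions of u is a chain. -/
theorem coprime_case_chain (m N : ℕ) [NeZero m] (u : List (Fin m)) (hu : u.length = N)
    (hsub : ∀ S : Multiset (Fin m), S ≤ (u : Multiset (Fin m)) →
      (S.map Fin.val).sum % m = 0 → S = 0 ∨ S = (u : Multiset (Fin m))) :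
    (∀ P S : Fin m → List (Fin m), forget P = u → Equitable P → IsBBS P S →
        (∃ k, S k ≠ []) → S = P) ∧
    (∀ P Q : Fin m → List (Fin m), forget P = u → Equitable P →
        forget Q = u → Equitable Q →
        (∀ i < N, blockIdx P i ≤ blockIdx Q i) ∨
        (∀ i < N, blockIdx Q i ≤ blockIdx P i)) := by
  subst hu
  refine ⟨fun P S hP _ hS hne => ?_, fun P Q hP heP hQ heQ => ?_⟩
  · have hsl : (forget S).Sublist (forget P) :=
      List.Sublist.flatMap_right _ fun k _ => (hS.1 k).sublist
    rcases hsub (forget S) (by rw [← hP]; exact hsl.subperm)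
      (by simpa [totalSum_eq_sum_forget] using hS.2) with h | h
    · obtain ⟨k, hk⟩ := hne
      rw [Multiset.coe_eq_zero, forget, List.flatMap_eq_nil_iff] at h
      exact absurd (h k (by simp)) hk
    · refine eq_of_suffix_of_length_forget_eq hS.1 ?_
      rw [hP]
      exact (Multiset.coe_eq_coe.1 h).length_eq
  · have hlt (R : Fin m → List (Fin m)) (i : ℕ) : (blockIdx R i : ℤ) < m := by
      exact_mod_cast Fin.is_lt _
    have htot : totalSum P = totalSum Q := by
      rw [totalSum_eq_sum_forget, totalSum_eq_sum_forget, hP, hQ]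
    refine (le_or_le_of_fillCount_eq (fun _ => Nat.cast_nonneg _)
      (fun i => by exact_mod_cast Fin.is_lt _) (eq_empty_or_univ_of_dvd_sum hsub)
      (antitone_blockIdx hP) (antitone_blockIdx hQ) (fun _ => Nat.cast_nonneg _)
      (fun i => hlt P i) (fun _ => Nat.cast_nonneg _) (fun i => hlt Q i) ?_
      (fun c hc0 hcm => fillCount_sub_of_equitable hP heP hc0 hcm)).imp
      (fun h i hi => by exact_mod_cast h ⟨i, hi⟩) (fun h i hi => by exact_mod_cast h ⟨i, hi⟩)
    intro c hc0 hcm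
    lift c to ℕ using hc0
    have hc : c < m := by exact_mod_cast hcm
    rw [← colCount_eq_fillCount hP ⟨c, hc⟩, ← colCount_eq_fillCount hQ ⟨c, hc⟩, heP, heQ,
      eqCount, eqCount, htot]
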